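/- arXiv:2107.11865 — 3 statements merged into one kernel-verified Lean document; each statement's English description precedes it below -/
import Mathlib

section
/- Let n ∈ ℕ, let h ∈ C¹_b(ℝⁿ) (continuously differentiable, bounded, with bounded derivatives) and let g₁,…,gₙ : M⁺(ℝ^d) → ℝ each be bounded, weakly continuous, with linear functional derivatives δg₁,…,δgₙ. Then the function μ ↦ h(g₁(μ),…,gₙ(μ)) is bounded, weakly continuous, and has linear functional derivative δ(h(g₁,…,gₙ))(μ,x) = Σᵢ₌₁ⁿ ∂ᵢh(g₁(μ),…,gₙ(μ)) · δgᵢ(μ,x) for all μ ∈ M⁺(ℝ^d), x ∈ ℝ^d. -/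
open MeasureTheory Set Filter Topology
open scoped NNReal ENNReal

noncomputable section

/-- `ℝ^d`. -/
abbrev Eu (d : ℕ) : Type := EuclideanSpace ℝ (Fin d)

/-- `M⁺(ℝ^d)`, the finite positive Borel measures on `ℝ^d`, with the weak topology. -/
abbrev Md (d : ℕ) : Type := MeasureTheory.FiniteMeasure (Eu d)

variable {d : ℕ}

/-- The segment `t μ' + (1 - t) μ` in the space of finite measures. -/
noncomputable def seg (μ μ' : Md d) (t : ℝ) : Md d :=
  t.toNNReal • μ' + (1 - t).toNNReal • μ

/-- `⟨μ, ψ⟩ = ∫ ψ dμ`. -/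
noncomputable def pairing (μ : Md d) (ψ : Eu d → ℝ) : ℝ :=
  ∫ x, ψ x ∂(μ : Measure (Eu d))

/-- `δu` is a linear functional derivative of `u : M⁺(ℝ^d) → ℝ`: it is bounded, jointly
continuous (weak topology on measures), and satisfies the fundamental identity. -/
def IsLFD (u : Md d → ℝ) (δu : Md d → Eu d → ℝ) : Prop :=
  (∃ C : ℝ, ∀ (μ : Md d) (x : Eu d), |δu μ x| ≤ C) ∧
  Continuous (fun p : Md d × Eu d => δu p.1 p.2) ∧
  ∀ μ μ' : Md d,
    u μ' - u μ =
      ∫ t in (0:ℝ)..1,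
        (pairing μ' (fun x => δu (seg μ μ' t) x) - pairing μ (fun x => δu (seg μ μ' t) x))

lemma continuous_seg (μ μ' : Md d) : Continuous (seg μ μ') := by
  rw [continuous_iff_continuousAt]
  intro t
  refine FiniteMeasure.tendsto_iff_forall_testAgainstNN_tendsto.mpr fun f => ?_
  have key (s : ℝ) : (seg μ μ' s).testAgainstNN f =
      s.toNNReal * μ'.testAgainstNN f + (1 - s).toNNReal * μ.testAgainstNN f := by
    rw [← smul_eq_mul, ← smul_eq_mul, ← FiniteMeasure.smul_testAgainstNN_apply,
      ← FiniteMeasure.smul_testAgainstNN_apply, ← ENNReal.coe_inj]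
    simp only [seg, ENNReal.coe_add, FiniteMeasure.testAgainstNN_coe_eq,
      FiniteMeasure.toMeasure_add, lintegral_add_measure]
  simp only [key]
  exact Continuous.tendsto (by fun_prop) t

lemma integrable_of_continuous_of_bounded (μ : Md d) {ψ : Eu d → ℝ} (hψ : Continuous ψ) {C : ℝ}
    (hC : ∀ x, |ψ x| ≤ C) : Integrable ψ (μ : Measure (Eu d)) :=
  Integrable.of_bound hψ.aestronglyMeasurable C (Eventually.of_forall hC)

lemma pairing_seg (μ μ' : Md d) {t : ℝ} (ht : t ∈ Icc (0 : ℝ) 1) {ψ : Eu d → ℝ}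
    (hψ : Continuous ψ) {C : ℝ} (hC : ∀ x, |ψ x| ≤ C) :
    pairing (seg μ μ' t) ψ = t * pairing μ' ψ + (1 - t) * pairing μ ψ := by
  have hi (ν : Md d) := integrable_of_continuous_of_bounded ν hψ hC
  have h1 : 0 ≤ 1 - t := sub_nonneg.mpr ht.2
  simp only [pairing, seg, FiniteMeasure.toMeasure_add, FiniteMeasure.toMeasure_smul]
  rw [integral_add_measure ((hi μ').smul_measure_nnreal) ((hi μ).smul_measure_nnreal),
    integral_smul_nnreal_measure, integral_smul_nnreal_measure]
  simp [NNReal.smul_def, ht.1, h1]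

lemma seg_seg (μ μ' : Md d) {s t : ℝ} (hs : s ∈ Icc (0 : ℝ) 1) (ht : t ∈ Icc (0 : ℝ) 1) :
    seg μ (seg μ μ' t) s = seg μ μ' (t * s) := by
  have h1 : 0 ≤ 1 - t := sub_nonneg.mpr ht.2
  have h2 : 0 ≤ 1 - s := sub_nonneg.mpr hs.2
  have h3 : 0 ≤ 1 - t * s := sub_nonneg.mpr (mul_le_one₀ ht.2 hs.1 hs.2)
  simp only [seg, smul_add, smul_smul, add_assoc, ← add_smul]
  congr 2
  · rw [Real.toNNReal_mul ht.1, mul_comm]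
  · rw [← Real.toNNReal_mul hs.1, ← Real.toNNReal_add (mul_nonneg hs.1 h1) h2]
    congr 1
    ring

@[simp] lemma seg_zero (μ μ' : Md d) : seg μ μ' 0 = μ := by simp [seg]

@[simp] lemma seg_one (μ μ' : Md d) : seg μ μ' 1 = μ' := by simp [seg]

lemma continuous_pairing_seg {f : Md d → Eu d → ℝ}
    (hf : Continuous (fun p : Md d × Eu d => f p.1 p.2)) {C : ℝ} (hC : ∀ μ x, |f μ x| ≤ C)
    (μ μ' ν : Md d) : Continuous fun t => pairing ν (fun x => f (seg μ μ' t) x) := by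
  refine continuous_of_dominated (bound := fun _ => C) (fun t => ?_)
    (fun t => Eventually.of_forall fun x => hC _ x) (integrable_const C)
    (Eventually.of_forall fun x => ?_)
  · exact (hf.comp (Continuous.prodMk_right (seg μ μ' t))).aestronglyMeasurable
  · exact hf.comp ((continuous_seg μ μ').prodMk continuous_const)

/-- Along a segment, `u` is a primitive of the pairing of its linear functional derivative with
the increment. -/
lemma IsLFD.sub_eq_integral {u : Md d → ℝ} {δu : Md d → Eu d → ℝ} (hu : IsLFD u δu)
    (μ μ' : Md d) {t : ℝ} (ht : t ∈ Icc (0 : ℝ) 1) :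
    u (seg μ μ' t) - u μ = ∫ s in (0 : ℝ)..t,
      (pairing μ' (fun x => δu (seg μ μ' s) x) - pairing μ (fun x => δu (seg μ μ' s) x)) := by
  obtain ⟨⟨C, hC⟩, hc, hid⟩ := hu
  rw [hid μ (seg μ μ' t)]
  have hF := intervalIntegral.mul_integral_comp_mul_left (a := 0) (b := 1) (c := t)
    (f := fun s => pairing μ' (fun x => δu (seg μ μ' s) x) - pairing μ (fun x => δu (seg μ μ' s) x))
  rw [mul_zero, mul_one] at hF
  rw [← hF, ← intervalIntegral.integral_const_mul]
  refine intervalIntegral.integral_congr fun s hs => ?_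
  rw [uIcc_of_le zero_le_one] at hs
  rw [seg_seg μ μ' hs ht, pairing_seg μ μ' ht
    (ψ := δu (seg μ μ' (t * s))) (hc.comp (Continuous.prodMk_right _)) (hC _)]
  ring

lemma IsLFD.hasDerivAt_seg {u : Md d → ℝ} {δu : Md d → Eu d → ℝ} (hu : IsLFD u δu)
    (μ μ' : Md d) {t : ℝ} (ht : t ∈ Ioo (0 : ℝ) 1) :
    HasDerivAt (fun s => u (seg μ μ' s))
      (pairing μ' (fun x => δu (seg μ μ' t) x) - pairing μ (fun x => δu (seg μ μ' t) x)) t := by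
  obtain ⟨C, hC⟩ := hu.1
  have hcont := (continuous_pairing_seg hu.2.1 hC μ μ' μ').sub
    (continuous_pairing_seg hu.2.1 hC μ μ' μ)
  refine ((hcont.integral_hasStrictDerivAt 0 t).hasDerivAt.const_add (u μ)).congr_of_eventuallyEq ?_
  filter_upwards [Icc_mem_nhds ht.1 ht.2] with s hs
  rw [← sub_eq_iff_eq_add']
  exact hu.sub_eq_integral μ μ' hs

/-- multivariate chain rule for the linear functional derivative. If
`h ∈ C¹_b(ℝⁿ)` and `g₁, …, gₙ : M⁺(ℝ^d) → ℝ` are bounded, weakly continuous with linear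
functional derivatives `δgᵢ`, then `μ ↦ h(g₁(μ), …, gₙ(μ))` is bounded, weakly continuous,
with linear functional derivative `(μ,x) ↦ Σᵢ ∂ᵢh(g₁(μ),…,gₙ(μ)) · δgᵢ(μ,x)`. -/
theorem stmt2 {n : ℕ} (h : (Fin n → ℝ) → ℝ) (hh : ContDiff ℝ 1 h)
    (hhb : ∃ C : ℝ, ∀ v : Fin n → ℝ, |h v| ≤ C)
    (hh'b : ∃ C : ℝ, ∀ v : Fin n → ℝ, ‖fderiv ℝ h v‖ ≤ C)
    (g : Fin n → Md d → ℝ) (δg : Fin n → Md d → Eu d → ℝ)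
    (hgb : ∀ i, ∃ C : ℝ, ∀ μ : Md d, |g i μ| ≤ C)
    (hgc : ∀ i, Continuous (g i))
    (hg : ∀ i, IsLFD (g i) (δg i)) :
    (∃ C : ℝ, ∀ μ : Md d, |h (fun i => g i μ)| ≤ C) ∧
    Continuous (fun μ : Md d => h (fun i => g i μ)) ∧
    IsLFD (fun μ : Md d => h (fun i => g i μ))
      (fun μ x => ∑ i : Fin n, fderiv ℝ h (fun j => g j μ) (Pi.single i 1) * δg i μ x) := by
  have hGc : Continuous fun μ : Md d => (fun i => g i μ) := continuous_pi hgc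
  have hdc (i : Fin n) : Continuous fun μ : Md d =>
      fderiv ℝ h (fun j => g j μ) (Pi.single i 1) :=
    ((hh.continuous_fderiv one_ne_zero).comp hGc).clm_apply continuous_const
  have hδc : Continuous fun p : Md d × Eu d =>
      ∑ i : Fin n, fderiv ℝ h (fun j => g j p.1) (Pi.single i 1) * δg i p.1 p.2 :=
    continuous_finsetSum _ fun i _ => ((hdc i).comp continuous_fst).mul (hg i).2.1
  choose B hB using fun i => (hg i).1
  obtain ⟨C, hC⟩ := hhb
  obtain ⟨K, hK⟩ := hh'b
  have hδb (μ : Md d) (x : Eu d) :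
      |∑ i : Fin n, fderiv ℝ h (fun j => g j μ) (Pi.single i 1) * δg i μ x| ≤ ∑ i, K * B i := by
    refine (Finset.abs_sum_le_sum_abs _ _).trans (Finset.sum_le_sum fun i _ => ?_)
    rw [abs_mul]
    have hdK : |fderiv ℝ h (fun j => g j μ) (Pi.single i 1)| ≤ K := by
      have := (fderiv ℝ h (fun j => g j μ)).le_of_opNorm_le (hK _) (Pi.single i 1)
      simpa [Pi.norm_single] using this
    exact mul_le_mul hdK (hB i μ x) (abs_nonneg _) ((abs_nonneg _).trans hdK)
  refine ⟨⟨C, fun μ => hC _⟩, hh.continuous.comp hGc, ⟨_, hδb⟩, hδc, fun μ μ' => ?_⟩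
  have hpair (ν ρ : Md d) : pairing ν (fun x => ∑ i : Fin n,
      fderiv ℝ h (fun j => g j ρ) (Pi.single i 1) * δg i ρ x) =
      ∑ i : Fin n, fderiv ℝ h (fun j => g j ρ) (Pi.single i 1) * pairing ν (δg i ρ) := by
    unfold pairing
    rw [integral_finsetSum]
    · simp only [integral_const_mul]
    · exact fun i _ => (integrable_of_continuous_of_bounded ν
        ((hg i).2.1.comp (Continuous.prodMk_right ρ)) (hB i ρ)).const_mul _
  have hcont := (continuous_pairing_seg hδc hδb μ μ' μ').sub
    (continuous_pairing_seg hδc hδb μ μ' μ)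
  refine Eq.trans ?_ (intervalIntegral.integral_eq_sub_of_hasDerivAt_of_le zero_le_one
    (f := fun t => h (fun i => g i (seg μ μ' t)))
    ((hh.continuous.comp hGc).comp (continuous_seg μ μ')).continuousOn (fun t ht => ?_)
    (hcont.intervalIntegrable 0 1)).symm
  · simp
  · have hG := hasDerivAt_pi.mpr fun i => (hg i).hasDerivAt_seg μ μ' ht
    have hd := ((hh.differentiable one_ne_zero) (fun i => g i (seg μ μ' t))).hasFDerivAt
    refine (hd.comp_hasDerivAt t hG).congr_deriv ?_
    rw [Pi.sub_apply, hpair, hpair, ← Finset.sum_sub_distrib, ← ContinuousLinearMap.coe_coe,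
      LinearMap.pi_apply_eq_sum_univ]
    refine Finset.sum_congr rfl fun i _ => ?_
    have hsingle : (fun j => if i = j then (1 : ℝ) else 0) = Pi.single i 1 := by
      ext j
      simp [Pi.single_apply, eq_comm]
    rw [smul_eq_mul, hsingle]
    ring

end
end

section
/- Let u : M⁺(ℝ^d) → ℝ be twice differentiable in the linear functional sense, with first-order linear functional derivative δu and second-order linear functional derivative δ²u. Then the second-order derivative is symmetric in its spatial arguments: δ²u(μ,x,y) = δ²u(μ,y,x) for every x, y ∈ ℝ^d and every μ ∈ M⁺(ℝ^d). -/
open MeasureTheory Set Filter Topology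
open scoped NNReal ENNReal

noncomputable section

variable {d : ℕ}

/-- The Dirac mass at `x`, as a finite measure on `ℝ^d`. -/
def diracFinite (x : Eu d) : Md d := ⟨Measure.dirac x, inferInstance⟩

lemma seg_add_smul (μ ν : Md d) (a : ℝ≥0) {t : ℝ} (ht : t ∈ Set.Icc (0 : ℝ) 1) :
    seg μ (μ + a • ν) t = μ + (t.toNNReal * a) • ν := by
  have h : t.toNNReal + (1 - t).toNNReal = 1 := by
    rw [← Real.toNNReal_add ht.1 (sub_nonneg.2 ht.2)]
    simp
  calc seg μ (μ + a • ν) t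
      = (t.toNNReal + (1 - t).toNNReal) • μ + (t.toNNReal * a) • ν := by
        rw [seg, smul_add, smul_smul, add_smul]
        abel
    _ = μ + (t.toNNReal * a) • ν := by rw [h, one_smul]

lemma pairing_add_smul_dirac (μ : Md d) (a : ℝ≥0) (x : Eu d) {ψ : Eu d → ℝ}
    (hψ : Continuous ψ) {C : ℝ} (hC : ∀ z, |ψ z| ≤ C) :
    pairing (μ + a • diracFinite x) ψ = pairing μ ψ + a * ψ x := by
  have hi (ν : Md d) : Integrable ψ (ν : Measure (Eu d)) :=
    Integrable.of_bound hψ.aestronglyMeasurable C (ae_of_all _ hC)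
  have hadd := integral_add_measure (hi μ) (hi (a • diracFinite x))
  have hdirac : ∫ z, ψ z ∂((a • diracFinite x : Md d) : Measure (Eu d)) = a * ψ x := by
    rw [FiniteMeasure.toMeasure_smul]
    change ∫ z, ψ z ∂(a • Measure.dirac x) = a * ψ x
    rw [integral_smul_nnreal_measure, integral_dirac]
    rfl
  rw [pairing, pairing, FiniteMeasure.toMeasure_add, hadd, hdirac]

/-- The fundamental identity along a segment in the direction of a Dirac mass. -/
lemma IsLFD.sub_eq_integral_dirac {w : Md d → ℝ} {δw : Md d → Eu d → ℝ} (hw : IsLFD w δw)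
    (μ : Md d) (a : ℝ≥0) (x : Eu d) :
    w (μ + a • diracFinite x) - w μ =
      a * ∫ t in (0 : ℝ)..1, δw (μ + (t.toNNReal * a) • diracFinite x) x := by
  obtain ⟨⟨C, hC⟩, hcont, hid⟩ := hw
  rw [hid, ← intervalIntegral.integral_const_mul]
  refine intervalIntegral.integral_congr fun t ht => ?_
  rw [uIcc_of_le zero_le_one] at ht
  rw [seg_add_smul μ _ a ht, pairing_add_smul_dirac (C := C) μ a x _ (hC _), add_sub_cancel_left]
  exact hcont.comp (Continuous.prodMk_right _)

lemma IsLFD.continuous_dirac {w : Md d → ℝ} {δw : Md d → Eu d → ℝ} (hw : IsLFD w δw)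
    (μ : Md d) (a : ℝ≥0) (x : Eu d) :
    Continuous fun t : ℝ => δw (μ + (t.toNNReal * a) • diracFinite x) x :=
  hw.2.1.comp (f := fun t : ℝ => (μ + (t.toNNReal * a) • diracFinite x, x))
    (by have := continuous_real_toNNReal; fun_prop)

lemma abs_intervalIntegral_sub_le {f : ℝ → ℝ} (hf : Continuous f) {c ε : ℝ}
    (h : ∀ t ∈ Set.Icc (0 : ℝ) 1, |f t - c| ≤ ε) : |(∫ t in (0 : ℝ)..1, f t) - c| ≤ ε := by
  have hsub : (∫ t in (0 : ℝ)..1, f t) - c = ∫ t in (0 : ℝ)..1, (f t - c) := by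
    rw [intervalIntegral.integral_sub (hf.intervalIntegrable _ _) (by simp)]
    simp
  rw [hsub]
  simpa using intervalIntegral.norm_integral_le_of_norm_le_const (a := 0) (b := 1) (C := ε)
    (f := fun t => f t - c) fun t ht => h t (by
      rw [uIoc_of_le zero_le_one] at ht
      exact ⟨ht.1.le, ht.2⟩)

lemma toNNReal_mul_le {t : ℝ} (ht : t ∈ Set.Icc (0 : ℝ) 1) (a : ℝ≥0) : t.toNNReal * a ≤ a :=
  mul_le_of_le_one_left zero_le (Real.toNNReal_le_one.2 ht.2)

/-- First-order expansion in the direction of a Dirac mass, with an explicit error bound. -/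
lemma IsLFD.abs_sub_sub_mul_le {w : Md d → ℝ} {δw : Md d → Eu d → ℝ} (hw : IsLFD w δw)
    {μ : Md d} {a : ℝ≥0} {x : Eu d} {c ε : ℝ}
    (h : ∀ s ≤ a, |δw (μ + s • diracFinite x) x - c| ≤ ε) :
    |w (μ + a • diracFinite x) - w μ - a * c| ≤ a * ε := by
  rw [hw.sub_eq_integral_dirac, ← mul_sub, abs_mul, NNReal.abs_eq]
  gcongr
  exact abs_intervalIntegral_sub_le (hw.continuous_dirac μ a x) fun t ht =>
    h _ (toNNReal_mul_le ht a)

/-- The second-order mixed difference of `u` in the directions of two Dirac masses is controlled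
by the second-order linear functional derivative. -/
lemma abs_mixed_difference_sub_le {u : Md d → ℝ} {δu : Md d → Eu d → ℝ}
    {δ2u : Md d → Eu d → Eu d → ℝ} (hu : IsLFD u δu)
    (hu2 : ∀ x : Eu d, IsLFD (fun μ => δu μ x) (fun μ y => δ2u μ x y))
    {μ : Md d} {a : ℝ≥0} {x y : Eu d} {c ε : ℝ}
    (h : ∀ s ≤ a, ∀ r ≤ a,
      |δ2u (μ + s • diracFinite x + r • diracFinite y) x y - c| ≤ ε) :
    |u (μ + a • diracFinite x + a • diracFinite y) - u (μ + a • diracFinite y)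
      - (u (μ + a • diracFinite x) - u μ) - a * (a * c)| ≤ a * (a * ε) := by
  have hx := hu.sub_eq_integral_dirac μ a x
  have hxy := hu.sub_eq_integral_dirac (μ + a • diracFinite y) a x
  rw [add_right_comm μ] at hxy
  have hcx := hu.continuous_dirac μ a x
  have hcxy := hu.continuous_dirac (μ + a • diracFinite y) a x
  rw [hxy, hx, ← mul_sub, ← intervalIntegral.integral_sub (hcxy.intervalIntegrable _ _)
    (hcx.intervalIntegrable _ _), ← mul_sub, abs_mul, NNReal.abs_eq]
  gcongr
  refine abs_intervalIntegral_sub_le (hcxy.sub hcx) fun t ht => ?_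
  rw [Pi.sub_apply, add_right_comm μ]
  exact (hu2 x).abs_sub_sub_mul_le fun r hr => h _ (toNNReal_mul_le ht a) r hr

lemma exists_forall_le_abs_sub_le {f : ℝ≥0 × ℝ≥0 → ℝ} (hf : Continuous f) {ε : ℝ} (hε : 0 < ε) :
    ∃ a₀ : ℝ≥0, 0 < a₀ ∧ ∀ s ≤ a₀, ∀ r ≤ a₀, |f (s, r) - f 0| ≤ ε := by
  obtain ⟨η, hη, h⟩ := Metric.continuous_iff.1 hf 0 ε hε
  refine ⟨(η / 2).toNNReal, Real.toNNReal_pos.2 (half_pos hη), fun s hs r hr => ?_⟩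
  refine (h (s, r) ?_).le
  have hs' : (s : ℝ) ≤ η / 2 := (Real.le_toNNReal_iff_coe_le (half_pos hη).le).1 hs
  have hr' : (r : ℝ) ≤ η / 2 := (Real.le_toNNReal_iff_coe_le (half_pos hη).le).1 hr
  simp only [Prod.dist_eq, Prod.fst_zero, Prod.snd_zero, NNReal.dist_eq, NNReal.coe_zero,
    sub_zero, NNReal.abs_eq, sup_lt_iff]
  constructor <;> linarith

/-- symmetry of the second-order linear functional derivative. If `u` is
twice differentiable in the linear functional sense, with first derivative `δu` and
second derivative `δ²u` (bounded and jointly continuous in `(μ,x,y)`), then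
`δ²u(μ,x,y) = δ²u(μ,y,x)` for all `μ, x, y`. -/
theorem stmt7 (u : Md d → ℝ) (δu : Md d → Eu d → ℝ) (δ2u : Md d → Eu d → Eu d → ℝ)
    (hub : ∃ C : ℝ, ∀ μ : Md d, |u μ| ≤ C) (huc : Continuous u)
    (hu : IsLFD u δu)
    (hu2 : ∀ x : Eu d, IsLFD (fun μ => δu μ x) (fun μ y => δ2u μ x y))
    (h2b : ∃ C : ℝ, ∀ (μ : Md d) (x y : Eu d), |δ2u μ x y| ≤ C)
    (h2c : Continuous (fun p : Md d × Eu d × Eu d => δ2u p.1 p.2.1 p.2.2)) :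
    ∀ (μ : Md d) (x y : Eu d), δ2u μ x y = δ2u μ y x := by
  intro μ x y
  refine eq_of_forall_dist_le fun ε hε => ?_
  have hcont (x y : Eu d) : Continuous fun p : ℝ≥0 × ℝ≥0 =>
      δ2u (μ + p.1 • diracFinite x + p.2 • diracFinite y) x y :=
    h2c.comp (f := fun p : ℝ≥0 × ℝ≥0 =>
      (μ + p.1 • diracFinite x + p.2 • diracFinite y, x, y)) (by fun_prop)
  obtain ⟨a₁, ha₁, h₁⟩ := exists_forall_le_abs_sub_le (hcont x y) (half_pos hε)
  obtain ⟨a₂, ha₂, h₂⟩ := exists_forall_le_abs_sub_le (hcont y x) (half_pos hε)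
  simp only [Prod.fst_zero, Prod.snd_zero, zero_smul, add_zero] at h₁ h₂
  set a : ℝ≥0 := min a₁ a₂
  have ha : 0 < (a : ℝ) := NNReal.coe_pos.2 (lt_min ha₁ ha₂)
  have hxy := abs_mixed_difference_sub_le (a := a) hu hu2 fun s hs r hr =>
    h₁ s (hs.trans (min_le_left _ _)) r (hr.trans (min_le_left _ _))
  have hyx := abs_mixed_difference_sub_le (a := a) hu hu2 fun s hs r hr =>
    h₂ s (hs.trans (min_le_right _ _)) r (hr.trans (min_le_right _ _))
  rw [add_right_comm μ] at hyx
  have hsq : 0 < (a : ℝ) * a := mul_pos ha ha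
  rw [Real.dist_eq]
  refine le_of_mul_le_mul_left ?_ hsq
  rw [← abs_of_pos hsq, ← abs_mul, abs_of_pos hsq]
  rw [abs_le] at hxy hyx ⊢
  constructor <;> linarith

end
end

section
/- For each N ≥ 1 let ρᴺ : ℝ^d → [0,1] be a smooth cut-off function equal to 1 on [−N,N]^d and identically 0 outside [−N−1,N+1]^d, and for μ ∈ M⁺(ℝ^d) let ρᴺμ denote the measure with density ρᴺ with respect to μ. Let u : M⁺(ℝ^d) → ℝ be bounded, weakly continuous, with linear functional derivative δu, and define ûᴺ(μ) := u(ρᴺμ). Then: (a) for every μ ∈ M⁺(ℝ^d), ûᴺ(μ) → u(μ) as N → ∞; (b) (μ,x) ↦ ρᴺ(x)·δu(ρᴺμ, x) is a linear functional derivative of ûᴺ; (c) for every μ and x, ρᴺ(x)·δu(ρᴺμ, x) → δu(μ,x) as N → ∞; (d) sup_μ |ûᴺ(μ)| ≤ sup_μ |u(μ)| and sup_{μ,x} |ρᴺ(x)δu(ρᴺμ,x)| ≤ sup_{μ,x} |δu(μ,x)|. -/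
open MeasureTheory Set Filter Topology
open scoped NNReal ENNReal

noncomputable section

variable {d : ℕ}

/-- The measure `ρμ` with density `ρ` (valued in `[0,1]`) with respect to `μ`, as a
finite measure. -/
noncomputable def cutM (ρ : Eu d → ℝ) (hρ : ∀ x, ρ x ≤ 1) (μ : Md d) : Md d :=
  ⟨(μ : Measure (Eu d)).withDensity (fun x => ENNReal.ofReal (ρ x)), by
    refine isFiniteMeasure_withDensity ?_
    have h1 : (∫⁻ x, ENNReal.ofReal (ρ x) ∂(μ : Measure (Eu d))) ≤
        ∫⁻ _x, 1 ∂(μ : Measure (Eu d)) :=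
      lintegral_mono fun x => ENNReal.ofReal_le_one.mpr (hρ x)
    rw [lintegral_one] at h1
    exact ne_of_lt (lt_of_le_of_lt h1 (measure_lt_top _ _))⟩

lemma pairing_cutM {ρ : Eu d → ℝ} (hc : Continuous ρ) (h0 : ∀ x, 0 ≤ ρ x)
    (h1 : ∀ x, ρ x ≤ 1) (μ : Md d) (ψ : Eu d → ℝ) :
    pairing (cutM ρ h1 μ) ψ = pairing μ (fun x => ρ x * ψ x) := by
  have h := integral_withDensity_eq_integral_toReal_smul (μ := (μ : Measure (Eu d)))
    (f := fun x => ENNReal.ofReal (ρ x)) (ENNReal.measurable_ofReal.comp hc.measurable)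
    (Eventually.of_forall fun _ => ENNReal.ofReal_lt_top) ψ
  simp only [ENNReal.toReal_ofReal (h0 _), smul_eq_mul] at h
  exact h

lemma continuous_cutM {ρ : Eu d → ℝ} (hc : Continuous ρ) (h0 : ∀ x, 0 ≤ ρ x)
    (h1 : ∀ x, ρ x ≤ 1) : Continuous (cutM ρ h1) := by
  rw [continuous_iff_continuousAt]
  intro μ
  refine FiniteMeasure.tendsto_iff_forall_integral_tendsto.2 fun f => ?_
  let g : BoundedContinuousFunction (Eu d) ℝ := BoundedContinuousFunction.ofNormedAddCommGroup
    (fun x => ρ x * f x) (hc.mul f.continuous) ‖f‖ fun x => by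
      rw [norm_mul, Real.norm_of_nonneg (h0 x)]
      exact (mul_le_of_le_one_left (norm_nonneg _) (h1 x)).trans (f.norm_coe_le_norm x)
  have h := FiniteMeasure.tendsto_iff_forall_integral_tendsto.1 (tendsto_id (x := 𝓝 μ)) g
  exact (h.congr fun ν => (pairing_cutM hc h0 h1 ν f).symm).trans_eq
    (congrArg 𝓝 (pairing_cutM hc h0 h1 μ f).symm)

lemma cutM_seg {ρ : Eu d → ℝ} (h1 : ∀ x, ρ x ≤ 1) (μ μ' : Md d) (t : ℝ) :
    cutM ρ h1 (seg μ μ' t) = seg (cutM ρ h1 μ) (cutM ρ h1 μ') t := by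
  apply Subtype.ext
  change (t.toNNReal • (μ' : Measure (Eu d)) +
    (1 - t).toNNReal • (μ : Measure (Eu d))).withDensity _ = t.toNNReal • (μ' : Measure (Eu d)).withDensity _
      + (1 - t).toNNReal • (μ : Measure (Eu d)).withDensity _
  rw [withDensity_add_measure]
  exact congrArg₂ _ (withDensity_smul_measure _ _) (withDensity_smul_measure _ _)

lemma IsLFD.comp_cutM {ρ : Eu d → ℝ} (hc : Continuous ρ) (h0 : ∀ x, 0 ≤ ρ x)
    (h1 : ∀ x, ρ x ≤ 1)
    {u : Md d → ℝ} {δu : Md d → Eu d → ℝ} (hu : IsLFD u δu) :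
    IsLFD (fun μ => u (cutM ρ h1 μ)) (fun μ x => ρ x * δu (cutM ρ h1 μ) x) := by
  obtain ⟨⟨C, hC⟩, hcont, hint⟩ := hu
  refine ⟨⟨C, fun μ x => ?_⟩, ?_, fun μ μ' => ?_⟩
  · rw [abs_mul, abs_of_nonneg (h0 x)]
    exact (mul_le_of_le_one_left (abs_nonneg _) (h1 x)).trans (hC _ x)
  · exact (hc.comp continuous_snd).mul (hcont.comp
      (((continuous_cutM hc h0 h1).comp continuous_fst).prodMk continuous_snd))
  · simp only [hint, pairing_cutM hc h0, cutM_seg]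

lemma tendsto_cutM {ρ : ℕ → Eu d → ℝ} (hc : ∀ N, Continuous (ρ N)) (h0 : ∀ N x, 0 ≤ ρ N x)
    (h1 : ∀ N x, ρ N x ≤ 1) (hlim : ∀ x, Tendsto (fun N => ρ N x) atTop (𝓝 1)) (μ : Md d) :
    Tendsto (fun N => cutM (ρ N) (h1 N) μ) atTop (𝓝 μ) := by
  refine FiniteMeasure.tendsto_iff_forall_integral_tendsto.2 fun f => ?_
  refine Tendsto.congr (fun N => (pairing_cutM (hc N) (h0 N) (h1 N) μ f).symm) ?_
  refine tendsto_integral_of_dominated_convergence (fun _ => ‖f‖)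
    (fun N => ((hc N).mul f.continuous).aestronglyMeasurable) (integrable_const _)
    (fun N => Eventually.of_forall fun x => ?_) (Eventually.of_forall fun x => ?_)
  · rw [norm_mul, Real.norm_of_nonneg (h0 N x)]
    exact (mul_le_of_le_one_left (norm_nonneg _) (h1 N x)).trans (f.norm_coe_le_norm x)
  · simpa using (hlim x).mul_const (f x)

/-- approximation by cut-off. Let `ρᴺ` be smooth `[0,1]`-valued cut-off
functions, `≡ 1` on `[−N,N]^d` and `≡ 0` outside `[−N−1,N+1]^d`, and let `u` be bounded
(by `Cu`), weakly continuous, with linear functional derivative `δu` (bounded by `Cδ`).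
Set `ûᴺ(μ) := u(ρᴺμ)`.  Then (a) `ûᴺ(μ) → u(μ)`; (b) `(μ,x) ↦ ρᴺ(x)δu(ρᴺμ,x)` is a
linear functional derivative of `ûᴺ`; (c) `ρᴺ(x)δu(ρᴺμ,x) → δu(μ,x)` pointwise; and
(d) `ûᴺ` and its derivative obey the same bounds `Cu`, `Cδ` as `u` and `δu`. -/
theorem stmt14 (ρ : ℕ → Eu d → ℝ)
    (hsm : ∀ N, ContDiff ℝ (⊤ : ℕ∞) (ρ N))
    (hrange : ∀ N x, ρ N x ∈ Set.Icc (0:ℝ) 1)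
    (hone : ∀ (N : ℕ) (x : Eu d), (∀ i, |x i| ≤ (N : ℝ)) → ρ N x = 1)
    (hzero : ∀ (N : ℕ) (x : Eu d), ¬ (∀ i, |x i| ≤ (N : ℝ) + 1) → ρ N x = 0)
    (u : Md d → ℝ) (δu : Md d → Eu d → ℝ)
    (Cu Cδ : ℝ) (hub : ∀ μ : Md d, |u μ| ≤ Cu) (huc : Continuous u)
    (hu : IsLFD u δu) (hδb : ∀ (μ : Md d) (x : Eu d), |δu μ x| ≤ Cδ) :
    (∀ μ : Md d, Filter.Tendsto
      (fun N => u (cutM (ρ N) (fun x => (hrange N x).2) μ)) Filter.atTop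
      (nhds (u μ))) ∧
    (∀ N : ℕ, IsLFD (fun μ => u (cutM (ρ N) (fun x => (hrange N x).2) μ))
      (fun μ x => ρ N x * δu (cutM (ρ N) (fun x => (hrange N x).2) μ) x)) ∧
    (∀ (μ : Md d) (x : Eu d), Filter.Tendsto
      (fun N => ρ N x * δu (cutM (ρ N) (fun x => (hrange N x).2) μ) x) Filter.atTop
      (nhds (δu μ x))) ∧
    (∀ (N : ℕ) (μ : Md d), |u (cutM (ρ N) (fun x => (hrange N x).2) μ)| ≤ Cu) ∧
    (∀ (N : ℕ) (μ : Md d) (x : Eu d),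
      |ρ N x * δu (cutM (ρ N) (fun x => (hrange N x).2) μ) x| ≤ Cδ) := by
  have hc : ∀ N, Continuous (ρ N) := fun N => (hsm N).continuous
  have h0 : ∀ N x, 0 ≤ ρ N x := fun N x => (hrange N x).1
  have h1 : ∀ N x, ρ N x ≤ 1 := fun N x => (hrange N x).2
  have hlim : ∀ x, Tendsto (fun N => ρ N x) atTop (𝓝 1) := by
    intro x
    refine tendsto_const_nhds.congr' ?_
    filter_upwards [eventually_ge_atTop ⌈‖x‖⌉₊] with N hN
    exact (hone N x fun i => (PiLp.norm_apply_le x i).trans (Nat.ceil_le.1 hN)).symm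
  have hμ := tendsto_cutM hc h0 h1 hlim
  refine ⟨fun μ => (huc.tendsto μ).comp (hμ μ), fun N => hu.comp_cutM (hc N) (h0 N) (h1 N),
    fun μ x => ?_, fun N μ => hub _, fun N μ x => ?_⟩
  · simpa using (hlim x).mul
      ((hu.2.1.tendsto (μ, x)).comp ((hμ μ).prodMk_nhds tendsto_const_nhds))
  · rw [abs_mul, abs_of_nonneg (h0 N x)]
    exact (mul_le_of_le_one_left (abs_nonneg _) (h1 N x)).trans (hδb _ x)

end
end
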